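/- Let a ∈ ℝ, x₀ ≥ 0, and let w : [0,∞)→ℝ be continuous with w(0) = 0. Let x̄, x̃ : [0,∞)→[0,∞) be continuous, let ℓ̄ be a boundary term for x̄ and ℓ̃ a boundary term for x̃, and let μ, ν : [0,∞)→[0,∞) be continuous nondecreasing with μ(0) = ν(0) = 0. Suppose that for all t ≥ 0: x̄(t) = x₀ + w(t) + ℓ̄(t) + aμ(t) and x̃(t) = x₀ + w(t) + ℓ̃(t) + aν(t). Then for every t ≥ 0, (x̄(t) − x̃(t))² ≤ 2a ( ∫₀ᵗ (x̄(s) − x̃(s)) dμ(s) − ∫₀ᵗ (x̄(s) − x̃(s)) dν(s) ), where the integrals are with respect to the Lebesgue–Stieltjes measures induced by μ and ν. -/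

import Mathlib

open MeasureTheory Set

noncomputable def nnegPart (r : ℝ) : ℝ := max (-r) 0

open Classical in
noncomputable def lsMeasure (f : ℝ → ℝ) : Measure ℝ :=
  if h : Monotone f ∧ Continuous f then
    StieltjesFunction.measure
      { toFun := f, mono' := h.1, right_continuous' := fun _ => h.2.continuousWithinAt }
  else 0

def IsBoundaryTerm (x ℓ : ℝ → ℝ) : Prop :=
  Continuous ℓ ∧ Monotone ℓ ∧ (∀ s ≤ (0:ℝ), ℓ s = 0) ∧
    ∫⁻ s in Set.Ici (0:ℝ), ENNReal.ofReal (x s) ∂(lsMeasure ℓ) = 0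

noncomputable def supNorm (f : ℝ → ℝ) (t : ℝ) : ℝ :=
  sSup ((fun s => |f s|) '' Set.Icc 0 t)

noncomputable def modCont (f : ℝ → ℝ) (t δ : ℝ) : ℝ :=
  sSup ((fun p : ℝ × ℝ => |f p.1 - f p.2|) ''
    {p : ℝ × ℝ | p.1 ∈ Set.Icc 0 t ∧ p.2 ∈ Set.Icc 0 t ∧ |p.1 - p.2| ≤ δ})

noncomputable def penalty (ε : ℝ) (x : ℝ) : ℝ :=
  if x ≤ -ε then ε⁻¹ else if x < 0 then -(x / ε ^ 2) else 0

def HomogeneousSystem (n : ℕ) (a : ℝ) (x0 : Fin n → ℝ)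
    (w x ℓ : Fin n → ℝ → ℝ) : Prop :=
  (∀ i, 0 ≤ x0 i) ∧ (∀ i, Continuous (w i)) ∧ (∀ i, w i 0 = 0) ∧
  (∀ i, Continuous (x i)) ∧ (∀ i t, 0 ≤ t → 0 ≤ x i t) ∧
  (∀ i, IsBoundaryTerm (x i) (ℓ i)) ∧
  (∀ i t, 0 ≤ t → x i t = x0 i + w i t + ℓ i t +
      a * (((n : ℝ) - 1)⁻¹ * ∑ j ∈ Finset.univ.erase i, ℓ j t))

def CompletelyS {n : ℕ} (R : Matrix (Fin n) (Fin n) ℝ) : Prop :=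
  ∀ J : Finset (Fin n), J.Nonempty →
    ∃ x : Fin n → ℝ, (∀ j ∈ J, 0 ≤ x j) ∧ ∀ i ∈ J, 0 < ∑ j ∈ J, R i j * x j

/-- The Stieltjes measure of the interval `(a, b]`. -/
theorem lsMeasure_Ioc {f : ℝ → ℝ} (hm : Monotone f) (hc : Continuous f) (a b : ℝ) :
    lsMeasure f (Ioc a b) = ENNReal.ofReal (f b - f a) := by
  rw [lsMeasure, dif_pos ⟨hm, hc⟩, StieltjesFunction.measure_Ioc]

theorem lsMeasure_singleton {f : ℝ → ℝ} (hm : Monotone f) (hc : Continuous f) (a : ℝ) :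
    lsMeasure f {a} = 0 := by
  rw [lsMeasure, dif_pos ⟨hm, hc⟩, StieltjesFunction.measure_singleton]
  have h : Function.leftLim f a = f a := hc.continuousWithinAt.leftLim_eq
  exact (congrArg (fun y => ENNReal.ofReal (f a - y)) h).trans (by simp)

theorem nullSingletonClass_lsMeasure {f : ℝ → ℝ} (hm : Monotone f) (hc : Continuous f) :
    NullSingletonClass (lsMeasure f) :=
  ⟨lsMeasure_singleton hm hc⟩

theorem isLocallyFiniteMeasure_lsMeasure {f : ℝ → ℝ} (hm : Monotone f) (hc : Continuous f) :
    IsLocallyFiniteMeasure (lsMeasure f) := by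
  rw [lsMeasure, dif_pos ⟨hm, hc⟩]
  infer_instance

theorem lintegral_measure_Iic_add_lintegral_measure_Iic (P Q : Measure ℝ) [SFinite P] [SFinite Q]
    [NullSingletonClass Q] :
    ∫⁻ s, P (Iic s) ∂Q + ∫⁻ u, Q (Iic u) ∂P = P univ * Q univ := by
  have hS : MeasurableSet {p : ℝ × ℝ | p.1 ≤ p.2} := measurableSet_le measurable_fst measurable_snd
  have h := measure_add_measure_compl (μ := P.prod Q) hS
  rw [Measure.prod_apply_symm hS, Measure.prod_apply hS.compl, ← univ_prod_univ,
    Measure.prod_prod] at h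
  rw [← h]
  congr 1
  refine lintegral_congr fun u => ?_
  rw [← measure_congr (Iio_ae_eq_Iic (μ := Q) (a := u))]
  congr 1
  ext s
  simp

/-- Integration by parts for continuous monotone functions vanishing at the origin. -/
theorem setIntegral_lsMeasure_add_setIntegral_lsMeasure {f g : ℝ → ℝ}
    (hfm : Monotone f) (hfc : Continuous f) (hf0 : f 0 = 0)
    (hgm : Monotone g) (hgc : Continuous g) (hg0 : g 0 = 0) {t : ℝ} (ht : 0 ≤ t) :
    ∫ s in Icc 0 t, f s ∂(lsMeasure g) + ∫ s in Icc 0 t, g s ∂(lsMeasure f) = f t * g t := by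
  have key : ∀ {f g : ℝ → ℝ}, Monotone f → Continuous f → f 0 = 0 → Monotone g → Continuous g →
      ∫ s in Icc 0 t, f s ∂(lsMeasure g) =
      (∫⁻ s in Ioc 0 t, (lsMeasure f).restrict (Ioc 0 t) (Iic s) ∂(lsMeasure g)).toReal := by
    intro f g hfm hfc hf0 hgm hgc
    have := nullSingletonClass_lsMeasure hgm hgc
    rw [integral_Icc_eq_integral_Ioc, integral_eq_lintegral_of_nonneg_ae
      ((ae_restrict_iff' measurableSet_Ioc).2 (ae_of_all _ fun s hs => hf0.symm.trans_le (hfm hs.1.le)))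
      hfc.aestronglyMeasurable]
    congr 1
    refine setLIntegral_congr_fun measurableSet_Ioc fun s hs => ?_
    have : Iic s ∩ Ioc 0 t = Ioc 0 s := by
      ext u
      exact ⟨fun h => ⟨h.2.1, h.1⟩, fun h => ⟨h.2, h.1, h.2.trans hs.2⟩⟩
    rw [Measure.restrict_apply measurableSet_Iic, this, lsMeasure_Ioc hfm hfc, hf0, sub_zero]
  have := nullSingletonClass_lsMeasure hgm hgc
  have := isLocallyFiniteMeasure_lsMeasure hgm hgc
  have := isLocallyFiniteMeasure_lsMeasure hfm hfc
  have hsum := lintegral_measure_Iic_add_lintegral_measure_Iic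
    ((lsMeasure f).restrict (Ioc 0 t)) ((lsMeasure g).restrict (Ioc 0 t))
  simp only [Measure.restrict_apply_univ, lsMeasure_Ioc hfm hfc, lsMeasure_Ioc hgm hgc, hf0, hg0,
    sub_zero] at hsum
  have hfin := hsum.trans_ne (ENNReal.mul_ne_top ENNReal.ofReal_ne_top ENNReal.ofReal_ne_top)
  rw [key hfm hfc hf0 hgm hgc, key hgm hgc hg0 hfm hfc,
    ← ENNReal.toReal_add (ENNReal.add_ne_top.1 hfin).1 (ENNReal.add_ne_top.1 hfin).2, hsum,
    ENNReal.toReal_mul, ENNReal.toReal_ofReal (hf0 ▸ hfm ht), ENNReal.toReal_ofReal (hg0 ▸ hgm ht)]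

theorem IsBoundaryTerm.setIntegral_eq_zero {x ℓ : ℝ → ℝ} (h : IsBoundaryTerm x ℓ)
    (hc : Continuous x) (hnn : ∀ t, 0 ≤ t → 0 ≤ x t) (t : ℝ) :
    ∫ s in Icc 0 t, x s ∂(lsMeasure ℓ) = 0 := by
  rw [integral_eq_lintegral_of_nonneg_ae
    ((ae_restrict_iff' measurableSet_Icc).2 (ae_of_all _ fun s hs => hnn s hs.1))
    hc.aestronglyMeasurable]
  have : ∫⁻ s in Icc 0 t, ENNReal.ofReal (x s) ∂(lsMeasure ℓ) = 0 :=
    le_antisymm ((lintegral_mono_set Icc_subset_Ici_self).trans_eq h.2.2.2) zero_le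
  rw [this, ENNReal.toReal_zero]

theorem stmt16 (a x₀ : ℝ) (hx₀ : 0 ≤ x₀)
    (w : ℝ → ℝ) (hw : Continuous w) (hw0 : w 0 = 0)
    (xbar xtil : ℝ → ℝ)
    (hxbarc : Continuous xbar) (hxbarnn : ∀ t, 0 ≤ t → 0 ≤ xbar t)
    (hxtilc : Continuous xtil) (hxtilnn : ∀ t, 0 ≤ t → 0 ≤ xtil t)
    (ℓbar ℓtil : ℝ → ℝ)
    (hbbar : IsBoundaryTerm xbar ℓbar) (hbtil : IsBoundaryTerm xtil ℓtil)
    (μ ν : ℝ → ℝ)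
    (hμc : Continuous μ) (hμm : Monotone μ) (hμ0 : ∀ s ≤ (0:ℝ), μ s = 0)
    (hνc : Continuous ν) (hνm : Monotone ν) (hν0 : ∀ s ≤ (0:ℝ), ν s = 0)
    (heqbar : ∀ t, 0 ≤ t → xbar t = x₀ + w t + ℓbar t + a * μ t)
    (heqtil : ∀ t, 0 ≤ t → xtil t = x₀ + w t + ℓtil t + a * ν t) :
    ∀ t, 0 ≤ t →
      (xbar t - xtil t) ^ 2
        ≤ 2 * a * ((∫ s in Set.Icc 0 t, (xbar s - xtil s) ∂(lsMeasure μ))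
            - ∫ s in Set.Icc 0 t, (xbar s - xtil s) ∂(lsMeasure ν)) := by
  intro t ht
  obtain ⟨hbc, hbm, hb0, -⟩ := id hbbar
  obtain ⟨hlc, hlm, hl0, -⟩ := id hbtil
  have hint : ∀ {f g : ℝ → ℝ}, Continuous f → Monotone g → Continuous g →
      IntegrableOn f (Icc 0 t) (lsMeasure g) := fun hf hgm hgc =>
    have := isLocallyFiniteMeasure_lsMeasure hgm hgc
    hf.continuousOn.integrableOn_Icc
  have hexp : ∀ {g : ℝ → ℝ}, Monotone g → Continuous g →
      ∫ s in Icc 0 t, (xbar s - xtil s) ∂(lsMeasure g) =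
        ∫ s in Icc 0 t, ℓbar s ∂(lsMeasure g) - ∫ s in Icc 0 t, ℓtil s ∂(lsMeasure g) +
        a * (∫ s in Icc 0 t, μ s ∂(lsMeasure g) - ∫ s in Icc 0 t, ν s ∂(lsMeasure g)) := by
    intro g hgm hgc
    rw [← integral_sub (hint hbc hgm hgc) (hint hlc hgm hgc),
      ← integral_sub (hint hμc hgm hgc) (hint hνc hgm hgc), ← integral_const_mul,
      ← integral_add (hint (by fun_prop) hgm hgc) (hint (by fun_prop) hgm hgc)]
    refine setIntegral_congr_fun measurableSet_Icc fun s hs => ?_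
    simp only [heqbar s hs.1, heqtil s hs.1]
    ring
  have hbar : ∫ s in Icc 0 t, (xbar s - xtil s) ∂(lsMeasure ℓbar) ≤ 0 := by
    rw [integral_sub (hint hxbarc hbm hbc) (hint hxtilc hbm hbc),
      hbbar.setIntegral_eq_zero hxbarc hxbarnn, zero_sub, neg_nonpos]
    exact setIntegral_nonneg measurableSet_Icc fun s hs => hxtilnn s hs.1
  have htil : 0 ≤ ∫ s in Icc 0 t, (xbar s - xtil s) ∂(lsMeasure ℓtil) := by
    rw [integral_sub (hint hxbarc hlm hlc) (hint hxtilc hlm hlc),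
      hbtil.setIntegral_eq_zero hxtilc hxtilnn, sub_zero]
    exact setIntegral_nonneg measurableSet_Icc fun s hs => hxbarnn s hs.1
  have parts {f g : ℝ → ℝ} (hfm : Monotone f) (hfc : Continuous f) (hf0 : ∀ s ≤ (0 : ℝ), f s = 0)
      (hgm : Monotone g) (hgc : Continuous g) (hg0 : ∀ s ≤ (0 : ℝ), g s = 0) :=
    setIntegral_lsMeasure_add_setIntegral_lsMeasure hfm hfc (hf0 0 le_rfl) hgm hgc (hg0 0 le_rfl) ht
  have hsq : (xbar t - xtil t) ^ 2 =
      2 * (∫ s in Icc 0 t, (xbar s - xtil s) ∂(lsMeasure ℓbar) -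
        ∫ s in Icc 0 t, (xbar s - xtil s) ∂(lsMeasure ℓtil)) +
      2 * a * (∫ s in Icc 0 t, (xbar s - xtil s) ∂(lsMeasure μ) -
        ∫ s in Icc 0 t, (xbar s - xtil s) ∂(lsMeasure ν)) := by
    rw [hexp hbm hbc, hexp hlm hlc, hexp hμm hμc, hexp hνm hνc, heqbar t ht, heqtil t ht]
    linear_combination
      -parts hbm hbc hb0 hbm hbc hb0 - parts hlm hlc hl0 hlm hlc hl0
      - a ^ 2 * parts hμm hμc hμ0 hμm hμc hμ0 - a ^ 2 * parts hνm hνc hν0 hνm hνc hν0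
      + 2 * parts hbm hbc hb0 hlm hlc hl0 - 2 * a * parts hbm hbc hb0 hμm hμc hμ0
      + 2 * a * parts hbm hbc hb0 hνm hνc hν0 + 2 * a * parts hlm hlc hl0 hμm hμc hμ0
      - 2 * a * parts hlm hlc hl0 hνm hνc hν0 + 2 * a ^ 2 * parts hμm hμc hμ0 hνm hνc hν0
  linarith
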